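/- arXiv:1708.09584 — 2 statements merged into one kernel-verified Lean document; each statement's English description precedes it below -/
import Mathlib

section
/- Let a ≥ 1. Then the trace of the operator R_1R_2⋯R_{a−1} on V^{⊗a} (the empty product for a = 1 being the identity) equals Σ_{(α;β)⊨a} C(m, ℓ(α)) · C(n, ℓ(β)) · (−q)^{|β|−ℓ(β)} · (1−q)^{ℓ(α;β)−1}, where the sum is over all bicompositions (α;β) of a and C(x, k) denotes the binomial coefficient. -/
open Classical

noncomputable section

/-- The field `ℂ(t)` of rational functions over `ℂ`. -/
abbrev F : Type := RatFunc ℂ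

/-- The indeterminate `t`. -/
def tt : F := RatFunc.X

/-- `q = t²`. -/
def qq : F := tt ^ 2

/-- The matrix of the sign `q`-permutation operator `R` on `V ⊗ V`:
`Rmat m N kl ij` is the coefficient of `v_{kl.1} ⊗ v_{kl.2}` in `R (v_{ij.1} ⊗ v_{ij.2})`.
Here the basis of `V` is indexed by `Fin N` (0-indexed), and the index `x` is even
(parity `0`) iff `(x : ℕ) < m`, odd otherwise. -/
def Rmat (m N : ℕ) : Matrix (Fin N × Fin N) (Fin N × Fin N) F := fun kl ij =>
  if ij.1 < ij.2 then
    (if kl = ij then 1 - qq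
     else if kl = (ij.2, ij.1) then (if (ij.1 : ℕ) < m ∨ (ij.2 : ℕ) < m then tt else -tt)
     else 0)
  else if ij.2 < ij.1 then
    (if kl = (ij.2, ij.1) then (if (ij.1 : ℕ) < m ∨ (ij.2 : ℕ) < m then tt else -tt) else 0)
  else
    (if kl = ij then (if (ij.1 : ℕ) < m then 1 else -qq) else 0)

/-- The matrix of the operator `R_j` on `V^{⊗r}` (`1 ≤ j ≤ r-1`, acting on the `j`-th and
`(j+1)`-st tensor factors, 1-indexed); for `j` outside this range it is the identity. -/
def opR (m N r : ℕ) (j : ℕ) : Matrix (Fin r → Fin N) (Fin r → Fin N) F := fun f g =>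
  if h : 1 ≤ j ∧ j < r then
    (if (∀ x : Fin r, (x : ℕ) + 1 ≠ j → (x : ℕ) ≠ j → f x = g x) then 1 else 0) *
      Rmat m N (f ⟨j - 1, by omega⟩, f ⟨j, by omega⟩) (g ⟨j - 1, by omega⟩, g ⟨j, by omega⟩)
  else if f = g then 1 else 0

/-- The matrix of the operator `R_1 R_2 ⋯ R_{a-1}` on `V^{⊗r}` (operators acting on the right:
the product denotes `v ↦ R_{a-1}(⋯ R_1(v))`, whose matrix is `M_{a-1} ⋯ M_1`). -/
def Tarrow (m N r a : ℕ) : Matrix (Fin r → Fin N) (Fin r → Fin N) F :=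
  (((List.range' 1 (a - 1)).map (opR m N r)).reverse).prod

/-- The word `γ_μ`: the concatenation over the parts `μ_i` of `μ` of the generator indices
`a_{i-1}+1, a_{i-1}+2, …, a_i - 1`. -/
def heckeWord : List ℕ → ℕ → List ℕ
  | [], _ => []
  | c :: cs, off => List.range' (off + 1) (c - 1) ++ heckeWord cs (off + c)

/-- The matrix of the standard operator `T_{γ_μ}` on `V^{⊗r}`. -/
def Tgamma (m N r : ℕ) (μ : List ℕ) : Matrix (Fin r → Fin N) (Fin r → Fin N) F :=
  (((heckeWord μ 0).map (opR m N r)).reverse).prod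


/-! ### Sums over compositions -/

/-- Compositions of `b + 1` correspond to subsets of `{0, …, b - 1}`, the number of parts being
one more than the size of the subset. -/
theorem length_compositionEquiv_symm (b : ℕ) (s : Finset (Fin b)) :
    ((compositionEquiv (b + 1)).symm ((compositionAsSetEquiv (b + 1)).symm s)).length =
      s.card + 1 := by
  have hb : ((compositionAsSetEquiv (b + 1)).symm s).boundaries =
      insert 0 (insert (Fin.last (b + 1)) (s.map ((Fin.castSuccEmb).trans (Fin.succEmb _)))) := by
    ext i
    simp only [compositionAsSetEquiv, Equiv.coe_fn_symm_mk, Set.mem_toFinset, Set.mem_ofPred_eq,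
      Finset.mem_insert, Finset.mem_map, Fin.ext_iff, exists_prop]
    simp [eq_comm]
  have hlen : ((compositionEquiv (b + 1)).symm ((compositionAsSetEquiv (b + 1)).symm s)).length =
      ((compositionAsSetEquiv (b + 1)).symm s).length :=
    CompositionAsSet.toComposition_length _
  rw [hlen, CompositionAsSet.length, hb, Finset.card_insert_of_notMem,
    Finset.card_insert_of_notMem, Finset.card_map]
  · omega
  · simp only [Finset.mem_map, not_exists, not_and]
    intro x _ h
    have := congrArg Fin.val h
    simp at this
    omega
  · simp only [Finset.mem_insert, Finset.mem_map, not_or, not_exists, not_and]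
    refine ⟨fun h => by simpa using congrArg Fin.val h, fun x _ h => ?_⟩
    simpa using congrArg Fin.val h

theorem sum_composition_succ {M : Type*} [AddCommMonoid M] (b : ℕ) (g : ℕ → M) :
    ∑ α : Composition (b + 1), g α.length = ∑ s ∈ (Finset.range b).powerset, g (s.card + 1) := by
  rw [Finset.sum_powerset_apply_card (fun k => g (k + 1)), Finset.card_range]
  have h := Finset.sum_powerset_apply_card (fun k => g (k + 1))
    (x := (Finset.univ : Finset (Fin b)))
  rw [Finset.powerset_univ, Finset.card_univ, Fintype.card_fin] at h
  rw [← h]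
  refine (Fintype.sum_equiv
    ((compositionAsSetEquiv (b + 1)).symm.trans (compositionEquiv (b + 1)).symm) _ _ ?_).symm
  intro s
  rw [Equiv.trans_apply]
  exact congrArg g (length_compositionEquiv_symm b s).symm

theorem sum_composition_zero {M : Type*} [AddCommMonoid M] (g : ℕ → M) :
    ∑ α : Composition 0, g α.length = g 0 := by
  rw [Finset.sum_congr rfl fun α _ => congrArg g (Nat.le_zero.mp α.length_le), Finset.sum_const,
    Finset.card_univ, composition_card]
  simp

theorem sum_composition_one {M : Type*} [AddCommMonoid M] (g : ℕ → M) :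
    ∑ α : Composition 1, g α.length = g 1 := by
  simpa using sum_composition_succ 0 g

theorem sum_composition_add_two {M : Type*} [AddCommMonoid M] (b : ℕ) (g : ℕ → M) :
    ∑ α : Composition (b + 2), g α.length =
      ∑ α : Composition (b + 1), g α.length + ∑ α : Composition (b + 1), g (α.length + 1) := by
  rw [sum_composition_succ (b + 1) g, sum_composition_succ b g,
    sum_composition_succ b fun k => g (k + 1), Finset.range_add_one,
    Finset.sum_powerset_insert Finset.notMem_range_self]
  congr 1
  refine Finset.sum_congr rfl fun s hs => ?_
  rw [Finset.card_insert_of_notMem]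
  exact fun h => Finset.notMem_range_self (Finset.mem_powerset.mp hs h)

section GeneratingFunctions

open PowerSeries

variable {K : Type*} [CommRing K]

/-- The generating function of compositions `α` weighted by
`C(k, ℓ(α)) p ^ ℓ(α) e ^ (|α| - ℓ(α))`. -/
def compositionSeries (p e : K) (k : ℕ) : K⟦X⟧ :=
  PowerSeries.mk fun b =>
    ∑ α : Composition b, (k.choose α.length : K) * p ^ α.length * e ^ (b - α.length)

theorem compositionSeries_zero (p e : K) : compositionSeries p e 0 = 1 := by
  ext b
  rw [compositionSeries, coeff_mk, coeff_one]
  rcases b with _ | b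
  · rw [sum_composition_zero fun l => ((Nat.choose 0 l : ℕ) : K) * p ^ l * e ^ (0 - l)]
    simp
  · rw [if_neg b.succ_ne_zero]
    refine Finset.sum_eq_zero fun α _ => ?_
    rw [Nat.choose_eq_zero_of_lt (α.length_pos_of_pos b.succ_pos)]
    simp

/-- Removing or shortening the last part of a composition. -/
theorem coeff_add_two_compositionSeries (p e : K) (k b : ℕ) :
    coeff (b + 2) (compositionSeries p e k) = e * coeff (b + 1) (compositionSeries p e k) +
      ∑ α : Composition (b + 1),
        (k.choose (α.length + 1) : K) * p ^ (α.length + 1) * e ^ (b + 1 - α.length) := by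
  simp only [compositionSeries, coeff_mk]
  rw [sum_composition_add_two b fun l => (k.choose l : K) * p ^ l * e ^ (b + 2 - l),
    Finset.mul_sum]
  congr 1
  · refine Finset.sum_congr rfl fun α _ => ?_
    rw [Nat.succ_sub α.length_le, pow_succ]
    ring
  · refine Finset.sum_congr rfl fun α _ => ?_
    rw [Nat.add_sub_add_right (b + 1) 1]

theorem compositionSeries_succ (p e : K) (k : ℕ) :
    compositionSeries p e (k + 1) * (1 - C e * X) =
      compositionSeries p e k * (1 + C (p - e) * X) := by
  have h0 (k : ℕ) : coeff 0 (compositionSeries p e k) = 1 := by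
    rw [compositionSeries, coeff_mk,
      sum_composition_zero fun l => (k.choose l : K) * p ^ l * e ^ (0 - l)]
    simp
  have h1 (k : ℕ) : coeff 1 (compositionSeries p e k) = k * p := by
    rw [compositionSeries, coeff_mk,
      sum_composition_one fun l => (k.choose l : K) * p ^ l * e ^ (1 - l)]
    simp
  have key (f : K⟦X⟧) (c : K) (b : ℕ) :
      coeff (b + 1) (f * (C c * X)) = c * coeff b f := by
    rw [← mul_assoc, coeff_succ_mul_X, coeff_mul_C, mul_comm]
  ext b
  rw [mul_sub, mul_add, mul_one, mul_one, map_sub, map_add]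
  rcases b with _ | _ | b
  · rw [h0, h0]
    simp
  · rw [key, key, h0, h0, h1, h1]
    push_cast
    ring
  · rw [key, key, coeff_add_two_compositionSeries, coeff_add_two_compositionSeries, add_comm,
      add_sub_cancel_right]
    have hp : p * coeff (b + 1) (compositionSeries p e k) = ∑ α : Composition (b + 1),
        (k.choose α.length : K) * p ^ (α.length + 1) * e ^ (b + 1 - α.length) := by
      rw [compositionSeries, coeff_mk, Finset.mul_sum]
      exact Finset.sum_congr rfl fun α _ => by ring
    rw [sub_mul, hp]
    have hs : ∑ α : Composition (b + 1), ((k + 1).choose (α.length + 1) : K) *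
          p ^ (α.length + 1) * e ^ (b + 1 - α.length) =
        ∑ α : Composition (b + 1),
          (k.choose α.length : K) * p ^ (α.length + 1) * e ^ (b + 1 - α.length) +
        ∑ α : Composition (b + 1),
          (k.choose (α.length + 1) : K) * p ^ (α.length + 1) * e ^ (b + 1 - α.length) := by
      rw [← Finset.sum_add_distrib]
      refine Finset.sum_congr rfl fun α _ => ?_
      rw [Nat.choose_succ_succ]
      push_cast
      ring
    rw [hs]
    ring

theorem compositionSeries_mul_pow (p e : K) (k : ℕ) :
    compositionSeries p e k * (1 - C e * X) ^ k = (1 + C (p - e) * X) ^ k := by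
  induction k with
  | zero => simp [compositionSeries_zero]
  | succ k ih =>
    rw [pow_succ', ← mul_assoc, compositionSeries_succ, mul_right_comm, ih, pow_succ]

/-! ### Sums over weakly increasing sequences -/

/-- The transfer weights: `p` for an ascent, `e i` for a repeated value `i`, `0` for a descent. -/
def stepWeight {N : ℕ} (p : K) (e : ℕ → K) (i j : Fin N) : K :=
  if i < j then p else if j < i then 0 else e i

/-- The weighted sum over weakly increasing sequences of length `c + 1` in `{0, …, N - 1}`
starting with `i`. -/
def chainSum (N : ℕ) (p : K) (e : ℕ → K) : ℕ → ℕ → K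
  | 0, _ => 1
  | c + 1, i => e i * chainSum N p e c i + p * ∑ j ∈ Finset.Ico (i + 1) N, chainSum N p e c j

theorem sum_prod_stepWeight_cons (N : ℕ) (p : K) (e : ℕ → K) (c : ℕ) (i : Fin N) :
    ∑ f : Fin c → Fin N, ∏ x : Fin c,
        stepWeight p e ((Fin.cons i f : Fin (c + 1) → Fin N) x.castSucc)
          ((Fin.cons i f : Fin (c + 1) → Fin N) x.succ) =
      chainSum N p e c i := by
  induction c generalizing i with
  | zero => simp [chainSum]
  | succ c ih =>
    rw [← (Fin.consEquiv fun _ : Fin (c + 1) => Fin N).sum_comp, Fintype.sum_prod_type]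
    have hstep (j : Fin N) (f : Fin c → Fin N) :
        ∏ x : Fin (c + 1),
          stepWeight p e ((Fin.cons i (Fin.cons j f : Fin (c + 1) → Fin N) :
              Fin (c + 2) → Fin N) x.castSucc)
            ((Fin.cons i (Fin.cons j f : Fin (c + 1) → Fin N) : Fin (c + 2) → Fin N) x.succ) =
        stepWeight p e i j * ∏ x : Fin c,
          stepWeight p e ((Fin.cons j f : Fin (c + 1) → Fin N) x.castSucc)
            ((Fin.cons j f : Fin (c + 1) → Fin N) x.succ) := by
      rw [Fin.prod_univ_succ]
      simp
    have hsum : ∑ j : Fin N, stepWeight p e i j * chainSum N p e c j =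
        chainSum N p e (c + 1) i := by
      have hsplit (j : Fin N) : stepWeight p e i j * chainSum N p e c j =
          (if i = j then e i * chainSum N p e c i else 0) +
            (if (i : ℕ) < j then p * chainSum N p e c j else 0) := by
        rcases lt_trichotomy i j with h | h | h
        · simp [stepWeight, h, h.ne]
        · simp [stepWeight, h]
        · simp [stepWeight, h, h.ne', h.not_gt]
      rw [Finset.sum_congr rfl fun j _ => hsplit j, Finset.sum_add_distrib,
        Finset.sum_ite_eq, if_pos (Finset.mem_univ _), chainSum, Finset.mul_sum,
        Fin.sum_univ_eq_sum_range
          (fun j => if (i : ℕ) < j then p * chainSum N p e c j else 0) N,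
        ← Finset.sum_filter]
      congr 2
      ext j
      simp only [Finset.mem_filter, Finset.mem_range, Finset.mem_Ico]
      omega
    rw [← hsum]
    refine Finset.sum_congr rfl fun j _ => ?_
    rw [← ih j, Finset.mul_sum]
    exact Finset.sum_congr rfl fun f _ => hstep j f

theorem sum_prod_stepWeight (N : ℕ) (p : K) (e : ℕ → K) (c : ℕ) :
    ∑ f : Fin (c + 1) → Fin N, ∏ x : Fin c, stepWeight p e (f x.castSucc) (f x.succ) =
      ∑ i ∈ Finset.range N, chainSum N p e c i := by
  rw [← (Fin.consEquiv fun _ : Fin (c + 1) => Fin N).sum_comp, Fintype.sum_prod_type,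
    ← Fin.sum_univ_eq_sum_range]
  exact Finset.sum_congr rfl fun i _ => sum_prod_stepWeight_cons N p e c i

/-- The generating function of `chainSum` over starting points `≥ j`, scaled by `p` and with
constant term `1`. -/
def chainSeries (N : ℕ) (p : K) (e : ℕ → K) (j : ℕ) : K⟦X⟧ :=
  1 + C p * X * ∑ i ∈ Finset.Ico j N, PowerSeries.mk fun c => chainSum N p e c i

theorem chainSeries_mul (N : ℕ) (p : K) (e : ℕ → K) (j : ℕ) (hj : j < N) :
    chainSeries N p e j * (1 - C (e j) * X) =
      chainSeries N p e (j + 1) * (1 + C (p - e j) * X) := by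
  have hrec : (PowerSeries.mk fun c => chainSum N p e c j) * (1 - C (e j) * X) =
      chainSeries N p e (j + 1) := by
    ext c
    rw [chainSeries, mul_sub, mul_one, ← mul_assoc, mul_right_comm (C p) X, map_sub, map_add]
    rcases c with _ | c
    · simp [chainSum]
    · rw [coeff_succ_mul_X, coeff_succ_mul_X, coeff_mul_C, coeff_C_mul, map_sum]
      simp [chainSum]
      ring
  have hj' : chainSeries N p e j = chainSeries N p e (j + 1) +
      C p * X * PowerSeries.mk fun c => chainSum N p e c j := by
    rw [chainSeries, chainSeries, Finset.sum_eq_sum_Ico_succ_bot hj]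
    ring
  rw [hj', map_sub]
  linear_combination (C p * X) * hrec

theorem chainSeries_mul_prod (N : ℕ) (p : K) (e : ℕ → K) (k : ℕ) (hk : k ≤ N) :
    chainSeries N p e 0 * ∏ i ∈ Finset.range k, (1 - C (e i) * X) =
      chainSeries N p e k * ∏ i ∈ Finset.range k, (1 + C (p - e i) * X) := by
  induction k with
  | zero => simp
  | succ k ih =>
    rw [Finset.prod_range_succ, Finset.prod_range_succ, ← mul_assoc, ih (by omega),
      mul_right_comm, chainSeries_mul N p e k (by omega)]
    ring

theorem one_sub_C_mul_X_ne_zero [Nontrivial K] (c : K) : (1 - C c * X : K⟦X⟧) ≠ 0 := by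
  intro h
  simpa using congrArg (coeff 0) h

theorem prod_range_add_ite {M : Type*} [CommMonoid M] (m n : ℕ) (x y : M) :
    ∏ i ∈ Finset.range (m + n), (if i < m then x else y) = x ^ m * y ^ n := by
  rw [Finset.prod_range_add]
  congr 1
  · rw [Finset.prod_congr rfl fun i hi => if_pos (Finset.mem_range.mp hi)]
    simp
  · simp

theorem chainSeries_zero_eq [IsDomain K] (m n : ℕ) (p u v : K) :
    chainSeries (m + n) p (fun i => if i < m then u else v) 0 =
      compositionSeries p u m * compositionSeries p v n := by
  have h := chainSeries_mul_prod (m + n) p (fun i => if i < m then u else v) (m + n) le_rfl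
  have hN : chainSeries (m + n) p (fun i => if i < m then u else v) (m + n) = 1 := by
    simp [chainSeries]
  have h1 (i : ℕ) : (1 - C (if i < m then u else v) * X : K⟦X⟧) =
      if i < m then 1 - C u * X else 1 - C v * X := by split_ifs <;> rfl
  have h2 (i : ℕ) : (1 + C (p - if i < m then u else v) * X : K⟦X⟧) =
      if i < m then 1 + C (p - u) * X else 1 + C (p - v) * X := by split_ifs <;> rfl
  simp only [hN, h1, h2, prod_range_add_ite, one_mul] at h
  refine mul_right_cancel₀ (mul_ne_zero (pow_ne_zero m (one_sub_C_mul_X_ne_zero u))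
    (pow_ne_zero n (one_sub_C_mul_X_ne_zero v))) ?_
  rw [h, mul_mul_mul_comm, compositionSeries_mul_pow, compositionSeries_mul_pow]

theorem coeff_succ_chainSeries (N : ℕ) (p : K) (e : ℕ → K) (c : ℕ) :
    coeff (c + 1) (chainSeries N p e 0) = p * ∑ i ∈ Finset.range N, chainSum N p e c i := by
  rw [chainSeries, map_add, coeff_one, if_neg c.succ_ne_zero, zero_add, mul_assoc, coeff_C_mul,
    coeff_succ_X_mul, map_sum, Finset.range_eq_Ico]
  simp

end GeneratingFunctions

/-! ### Diagonal entries of `Tarrow` -/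

/-- The eigenvalue of `R` on `v_i ⊗ v_i`. -/
def diagWeight (m i : ℕ) : F := if i < m then 1 else -qq

theorem Rmat_apply_of_fst_eq (m N : ℕ) (i j k : Fin N) :
    Rmat m N (i, k) (i, j) = if k = j then stepWeight (1 - qq) (diagWeight m) i j else 0 := by
  rcases lt_trichotomy i j with h | rfl | h
  · by_cases hk : k = j
    · simp [Rmat, stepWeight, h, hk]
    · simp [Rmat, h, hk, h.ne]
  · by_cases hk : k = i <;> simp [Rmat, stepWeight, diagWeight, hk]
  · simp [Rmat, stepWeight, h, h.not_gt, h.ne']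

theorem Tarrow_succ_succ (m N r c : ℕ) :
    Tarrow m N r (c + 2) = opR m N r (c + 1) * Tarrow m N r (c + 1) := by
  simp [Tarrow, List.range'_concat, add_comm]

/-- If `f` and `g` agree on the first `c` positions, the swaps do not contribute to the entry
of `R_1 ⋯ R_c` at `(f, g)`. -/
theorem Tarrow_apply (m N r c : ℕ) (hc : c < r) (f g : Fin r → Fin N)
    (hfg : ∀ x : Fin r, (x : ℕ) < c → f x = g x) :
    Tarrow m N r (c + 1) f g = if f = g then
      ∏ x : Fin c, stepWeight (1 - qq) (diagWeight m) (g ⟨x, by omega⟩) (g ⟨x + 1, by omega⟩)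
      else 0 := by
  induction c generalizing f with
  | zero => simp [Tarrow, Matrix.one_apply]
  | succ c ih =>
    rw [Tarrow_succ_succ, Matrix.mul_apply, Finset.sum_eq_single g]
    · rw [ih (by omega) g fun _ _ => rfl, if_pos rfl, Fin.prod_univ_castSucc, opR,
        dif_pos ⟨by omega, hc⟩]
      simp only [Nat.add_sub_cancel, Fin.val_castSucc, Fin.val_last]
      rw [hfg ⟨c, by omega⟩ (by simp), Rmat_apply_of_fst_eq]
      by_cases h : f = g
      · subst h
        simp [mul_comm]
      · rw [if_neg h]
        by_cases hl : f ⟨c + 1, hc⟩ = g ⟨c + 1, hc⟩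
        · rw [if_neg, zero_mul, zero_mul]
          intro hall
          refine h (funext fun x => ?_)
          by_cases hx : (x : ℕ) < c + 1
          · exact hfg x hx
          · by_cases hx' : (x : ℕ) = c + 1
            · have : x = ⟨c + 1, hc⟩ := Fin.ext hx'
              rw [this, hl]
            · exact hall x (by omega) hx'
        · rw [if_neg hl, mul_zero, zero_mul]
    · intro h _ hne
      by_cases hall : ∀ x : Fin r, (x : ℕ) + 1 ≠ c + 1 → (x : ℕ) ≠ c + 1 → f x = h x
      · rw [ih (by omega) h fun x hx => by
          rw [← hall x (by omega) (by omega), hfg x (by omega)], if_neg hne, mul_zero]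
      · rw [opR, dif_pos ⟨by omega, hc⟩, if_neg hall, zero_mul, zero_mul]
    · simp

theorem trace_Tarrow_eq_sum_chainSum (m N c : ℕ) :
    Matrix.trace (Tarrow m N (c + 1) (c + 1)) =
      ∑ i ∈ Finset.range N, chainSum N (1 - qq) (diagWeight m) c i := by
  rw [← sum_prod_stepWeight, Matrix.trace]
  refine Finset.sum_congr rfl fun f _ => ?_
  rw [Matrix.diag_apply, Tarrow_apply m N (c + 1) c c.lt_succ_self f f fun _ _ => rfl, if_pos rfl]
  rfl

theorem one_sub_qq_ne_zero : (1 - qq : F) ≠ 0 := by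
  intro h
  have hX : (algebraMap (Polynomial ℂ) F) (1 - Polynomial.X ^ 2) = 0 := by
    simpa [qq, tt] using h
  have h0 := (map_eq_zero_iff _ (IsFractionRing.injective (Polynomial ℂ) F)).mp hX
  simpa using congrArg (Polynomial.eval 0) h0


/-- the trace of `R_1 R_2 ⋯ R_{a-1}` on `V^{⊗a}` equals the sum over all
bicompositions `(α;β) ⊨ a` of `C(m,ℓ(α)) C(n,ℓ(β)) (-q)^{|β|-ℓ(β)} (1-q)^{ℓ(α;β)-1}`.
(A bicomposition of `a` is encoded as `k ≤ a` together with a composition `α` of `k` and a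
composition `β` of `a - k`.) -/
theorem trace_Tarrow (m n a : ℕ) (hmn : 0 < m + n) (ha : 1 ≤ a) :
    Matrix.trace (Tarrow m (m + n) a a) =
      ∑ k ∈ Finset.range (a + 1), ∑ α : Composition k, ∑ β : Composition (a - k),
        (Nat.choose m α.length : F) * (Nat.choose n β.length : F) *
          (-qq) ^ (β.blocks.sum - β.length) * (1 - qq) ^ (α.length + β.length - 1) := by
  obtain ⟨c, rfl⟩ : ∃ c, a = c + 1 := ⟨a - 1, by omega⟩
  refine mul_left_cancel₀ one_sub_qq_ne_zero ?_
  rw [trace_Tarrow_eq_sum_chainSum, ← coeff_succ_chainSeries]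
  have h := chainSeries_zero_eq m n (1 - qq) 1 (-qq)
  change chainSeries (m + n) (1 - qq) (diagWeight m) 0 = _ at h
  rw [h, PowerSeries.coeff_mul, Finset.Nat.sum_antidiagonal_eq_sum_range_succ fun i j =>
    PowerSeries.coeff i (compositionSeries (1 - qq) 1 m) *
      PowerSeries.coeff j (compositionSeries (1 - qq) (-qq) n), Finset.mul_sum]
  refine Finset.sum_congr rfl fun k hk => ?_
  rw [compositionSeries, compositionSeries, PowerSeries.coeff_mk, PowerSeries.coeff_mk,
    Finset.sum_mul_sum, Finset.mul_sum]
  refine Finset.sum_congr rfl fun α _ => ?_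
  rw [Finset.mul_sum]
  refine Finset.sum_congr rfl fun β _ => ?_
  obtain ⟨l, hl⟩ : ∃ l, α.length + β.length = l + 1 := by
    refine ⟨α.length + β.length - 1, ?_⟩
    have hα := α.length_pos_of_pos
    have hβ := β.length_pos_of_pos
    omega
  have hpow : (1 - qq) ^ α.length * (1 - qq) ^ β.length = (1 - qq) * (1 - qq) ^ l := by
    rw [← pow_add, hl, pow_succ']
  rw [β.blocks_sum, hl, Nat.add_sub_cancel, one_pow]
  linear_combination ((m.choose α.length : F) * (n.choose β.length : F) *
    (-qq) ^ (c + 1 - k - β.length)) * hpow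

end
end

section
/- (The per-part (2,1) evaluation) For every integer a ≥ 1, the following identity holds in ℂ(q): Σ_{(α;β)⊨a} C(2, ℓ(α)) · C(1, ℓ(β)) · (−q)^{|β|−ℓ(β)} · (1−q)^{ℓ(α;β)−1} = (2 + 6q + 4(−q)^{a+1})/(1+q)² + (2a−1)(1−q)/(1+q), where the sum is over all bicompositions (α;β) of a (only terms with ℓ(α) ≤ 2 and ℓ(β) ≤ 1 are nonzero). -/
open Classical

noncomputable section

/-- The indeterminate `q`. -/
def qv : F := RatFunc.X

theorem card_composition_length_one {n : ℕ} (hn : 0 < n) :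
    (Finset.univ.filter fun c : Composition n => c.length = 1).card = 1 := by
  rw [Finset.card_eq_one]
  refine ⟨Composition.single n hn, ?_⟩
  ext c
  simp only [Finset.mem_filter, Finset.mem_univ, true_and, Finset.mem_singleton]
  exact (Composition.eq_single_iff_length hn).symm

theorem card_composition_length_two (n : ℕ) :
    (Finset.univ.filter fun c : Composition n => c.length = 2).card = n - 1 := by
  rw [← Finset.card_range (n - 1)]
  symm
  refine Finset.card_bij
    (fun i hi => (⟨[i + 1, n - 1 - i],
      by
        have := Finset.mem_range.mp hi
        simp only [List.mem_cons, List.not_mem_nil, or_false]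
        rintro j (rfl | rfl) <;> omega,
      by
        have := Finset.mem_range.mp hi
        simp only [List.sum_cons, List.sum_nil]
        omega⟩ : Composition n)) ?_ ?_ ?_
  · intro i hi
    simp [Composition.length]
  · intro i hi j hj h
    simpa using congrArg (fun c : Composition n => c.blocks.head?) h
  · intro c hc
    obtain ⟨u, v, huv⟩ := List.length_eq_two.mp (Finset.mem_filter.mp hc).2
    have hu : 0 < u := c.blocks_pos (by simp [huv])
    have hv : 0 < v := c.blocks_pos (by simp [huv])
    have hs : u + v = n := by simpa [huv] using c.blocks_sum
    refine ⟨u - 1, Finset.mem_range.mpr (by omega), ?_⟩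
    ext1
    simp only [huv, List.cons.injEq, and_true]
    omega

/-- The sum over the compositions of `n > 0` of a function of the length supported in `{0, 1, 2}`. -/
theorem sum_composition_length {R : Type*} [CommRing R] {n : ℕ} (hn : 0 < n) (f : ℕ → R)
    (hf : ∀ l, 2 < l → f l = 0) :
    ∑ c : Composition n, f c.length = f 1 + ((n : R) - 1) * f 2 := by
  have h (c : Composition n) :
      f c.length = (if c.length = 1 then f 1 else 0) + (if c.length = 2 then f 2 else 0) := by
    have hpos : 0 < c.length := c.length_pos_iff.mpr hn
    by_cases h1 : c.length = 1
    · simp [h1]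
    by_cases h2 : c.length = 2
    · simp [h2]
    rw [if_neg h1, if_neg h2, hf _ (by omega), add_zero]
  rw [Finset.sum_congr rfl fun c _ => h c, Finset.sum_add_distrib, ← Finset.sum_filter,
    ← Finset.sum_filter, Finset.sum_const, Finset.sum_const, card_composition_length_one hn,
    card_composition_length_two, one_nsmul, nsmul_eq_mul, Nat.cast_sub hn, Nat.cast_one]

theorem sum_composition_zero_length {R : Type*} [CommRing R] (f : ℕ → R) :
    ∑ c : Composition 0, f c.length = f 0 := by
  have h (c : Composition 0) : c.length = 0 := Nat.le_zero.mp c.length_le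
  simp only [h, Finset.sum_const, Finset.card_univ, composition_card]
  simp

/-- The inner sum over `β` when `β` is a composition of a positive integer. -/
theorem sum_right_composition {R : Type*} [CommRing R] (x y : R) {m : ℕ} (hm : 0 < m) (l : ℕ) :
    ∑ β : Composition m, (Nat.choose 2 l : R) * (Nat.choose 1 β.length : R) *
        x ^ (β.blocks.sum - β.length) * y ^ (l + β.length - 1) =
      (Nat.choose 2 l : R) * x ^ (m - 1) * y ^ l := by
  simp only [Composition.blocks_sum]
  rw [sum_composition_length hm (fun j => (Nat.choose 2 l : R) * (Nat.choose 1 j : R) *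
        x ^ (m - j) * y ^ (l + j - 1))
      (fun j hj => by simp [Nat.choose_eq_zero_of_lt (by omega : 1 < j)])]
  simp

theorem sum_right_composition_zero {R : Type*} [CommRing R] (x y : R) (l : ℕ) :
    ∑ β : Composition 0, (Nat.choose 2 l : R) * (Nat.choose 1 β.length : R) *
        x ^ (β.blocks.sum - β.length) * y ^ (l + β.length - 1) =
      (Nat.choose 2 l : R) * y ^ (l - 1) := by
  simp only [Composition.blocks_sum]
  rw [sum_composition_zero_length (fun j => (Nat.choose 2 l : R) * (Nat.choose 1 j : R) *
        x ^ (0 - j) * y ^ (l + j - 1))]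
  simp

/-- The sum over bicompositions of `n + 1`, reduced to a sum over the size of `α`. -/
theorem sum_bicomposition {R : Type*} [CommRing R] (x y : R) (n : ℕ) :
    (∑ k ∈ Finset.range (n + 1 + 1), ∑ α : Composition k, ∑ β : Composition (n + 1 - k),
      (Nat.choose 2 α.length : R) * (Nat.choose 1 β.length : R) *
        x ^ (β.blocks.sum - β.length) * y ^ (α.length + β.length - 1)) =
      (∑ j ∈ Finset.range n, x ^ (n - 1 - j) * (2 * y + j * y ^ 2)) + x ^ n + (2 + n * y) := by
  have htwo (l : ℕ) (hl : 2 < l) : (Nat.choose 2 l : R) = 0 := by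
    simp [Nat.choose_eq_zero_of_lt hl]
  rw [Finset.sum_range_succ, Finset.sum_range_succ']
  congr 1
  · congr 1
    · refine Finset.sum_congr rfl fun j hj => ?_
      have hj' := Finset.mem_range.mp hj
      rw [Finset.sum_congr rfl fun α _ =>
          sum_right_composition x y (by omega : 0 < n + 1 - (j + 1)) α.length,
        sum_composition_length j.succ_pos
          (fun l => (Nat.choose 2 l : R) * x ^ (n + 1 - (j + 1) - 1) * y ^ l)
          (fun l hl => by simp [htwo l hl]),
        show n + 1 - (j + 1) - 1 = n - 1 - j by omega]
      push_cast [Nat.choose_one_right, Nat.choose_self]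
      ring
    · rw [Finset.sum_congr rfl fun α _ =>
          sum_right_composition x y (by omega : 0 < n + 1 - 0) α.length,
        sum_composition_zero_length
          (fun l => (Nat.choose 2 l : R) * x ^ (n + 1 - 0 - 1) * y ^ l)]
      simp
  · rw [Nat.sub_self, Finset.sum_congr rfl fun α _ => sum_right_composition_zero x y α.length,
      sum_composition_length n.succ_pos (fun l => (Nat.choose 2 l : R) * y ^ (l - 1))
        (fun l hl => by simp [htwo l hl])]
    simp

theorem sum_pow_mul_succ {R : Type*} [CommRing R] (x : R) (g : ℕ → R) (n : ℕ) :
    ∑ j ∈ Finset.range (n + 1), x ^ (n - j) * g j =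
      x * ∑ j ∈ Finset.range n, x ^ (n - 1 - j) * g j + g n := by
  rw [Finset.sum_range_succ, Finset.mul_sum, Nat.sub_self, pow_zero, one_mul]
  congr 1
  refine Finset.sum_congr rfl fun j hj => ?_
  have := Finset.mem_range.mp hj
  rw [show n - j = n - 1 - j + 1 by omega, pow_succ]
  ring

theorem closed_form {K : Type*} [Field K] (q : K) (hq : 1 + q ≠ 0) (n : ℕ) :
    (∑ j ∈ Finset.range n, (-q) ^ (n - 1 - j) * (2 * (1 - q) + j * (1 - q) ^ 2)) + (-q) ^ n +
        (2 + n * (1 - q)) =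
      (2 + 6 * q + 4 * (-q) ^ (n + 2)) / (1 + q) ^ 2 +
        (2 * ((n + 1 : ℕ) : K) - 1) * (1 - q) / (1 + q) := by
  induction n with
  | zero =>
    simp only [Finset.range_zero, Finset.sum_empty]
    field_simp
    push_cast
    ring
  | succ n ih =>
    rw [Nat.add_sub_cancel, sum_pow_mul_succ (-q) (fun j : ℕ => 2 * (1 - q) + j * (1 - q) ^ 2),
      eq_sub_of_add_eq (eq_sub_of_add_eq ih)]
    push_cast
    field_simp
    ring

theorem one_add_qv_ne_zero : 1 + qv ≠ 0 := by
  have h : (1 + qv : F) = algebraMap (Polynomial ℂ) F (Polynomial.X + Polynomial.C 1) := by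
    simp [qv, add_comm]
  rw [h]
  exact RatFunc.algebraMap_ne_zero (Polynomial.X_add_C_ne_zero 1)

/-- the per-part `(2,1)` evaluation: summing
`C(2,ℓ(α)) C(1,ℓ(β)) (-q)^{|β|-ℓ(β)} (1-q)^{ℓ(α;β)-1}` over all bicompositions `(α;β) ⊨ a`
gives `(2 + 6q + 4(-q)^{a+1})/(1+q)² + (2a-1)(1-q)/(1+q)`.
(A bicomposition of `a` is encoded as `k ≤ a` together with a composition `α` of `k` and a
composition `β` of `a - k`.) -/
theorem per_part_two_one (a : ℕ) (ha : 1 ≤ a) :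
    (∑ k ∈ Finset.range (a + 1), ∑ α : Composition k, ∑ β : Composition (a - k),
      (Nat.choose 2 α.length : F) * (Nat.choose 1 β.length : F) *
        (-qv) ^ (β.blocks.sum - β.length) * (1 - qv) ^ (α.length + β.length - 1)) =
      (2 + 6 * qv + 4 * (-qv) ^ (a + 1)) / (1 + qv) ^ 2 +
        (2 * (a : F) - 1) * (1 - qv) / (1 + qv) := by
  obtain ⟨n, rfl⟩ := Nat.exists_eq_add_of_le' ha
  rw [sum_bicomposition (-qv) (1 - qv) n, closed_form qv one_add_qv_ne_zero n]

end
end
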